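/- Let c > 0. There exists a constant C > 0 depending only on c with the following property: for every R > 1, every ε > 0, every continuous E : (0,R] → ℝ with |E(r)| ≤ ε(1+r)^{−3}, and every g ∈ C²([0,R]) satisfying g''(r) + (1/r) g'(r) + (8c/(1+cr²)²) g(r) = E(r) for 0 < r < R together with g(0) = 0 and g'(0) = 0, one has |g(r)| ≤ C ε log(2 + r) for all r ∈ (0, R]. -/

import Mathlib

/-- Comparison principle: a function vanishing at the left end point is bounded by any `B` with
`B a = 0` whose derivative dominates that of the function on the interior. -/
theorem abs_le_of_abs_hasDerivAt_le {a b : ℝ} {f f' B B' : ℝ → ℝ}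
    (hf : ContinuousOn f (Set.Icc a b)) (hB : ContinuousOn B (Set.Icc a b))
    (hf' : ∀ x ∈ Set.Ioo a b, HasDerivAt f (f' x) x)
    (hB' : ∀ x ∈ Set.Ioo a b, HasDerivAt B (B' x) x)
    (hle : ∀ x ∈ Set.Ioo a b, |f' x| ≤ B' x) (hfa : f a = 0) (hBa : B a = 0) :
    ∀ x ∈ Set.Icc a b, |f x| ≤ B x := by
  intro x hx
  have ha : a ∈ Set.Icc a b := ⟨le_rfl, hx.1.trans hx.2⟩
  have hsub : MonotoneOn (fun y => B y - f y) (Set.Icc a b) := by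
    refine monotoneOn_of_hasDerivWithinAt_nonneg (f' := fun y => B' y - f' y)
      (convex_Icc a b) (hB.sub hf) ?_ ?_ <;> rw [interior_Icc] <;> intro y hy
    · exact ((hB' y hy).sub (hf' y hy)).hasDerivWithinAt
    · exact sub_nonneg.2 ((le_abs_self _).trans (hle y hy))
  have hadd : MonotoneOn (fun y => B y + f y) (Set.Icc a b) := by
    refine monotoneOn_of_hasDerivWithinAt_nonneg (f' := fun y => B' y + f' y)
      (convex_Icc a b) (hB.add hf) ?_ ?_ <;> rw [interior_Icc] <;> intro y hy
    · exact ((hB' y hy).add (hf' y hy)).hasDerivWithinAt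
    · linarith [(abs_le.1 (hle y hy)).1]
  have h₁ := hsub ha hx hx.1
  have h₂ := hadd ha hx hx.1
  simp only [hfa, hBa] at h₁ h₂
  exact abs_le.2 ⟨by linarith, by linarith⟩

/-- The bounded radial element of the kernel of the linearized Liouville operator. -/
noncomputable def liouvilleKernel (c r : ℝ) : ℝ := (1 - c * r ^ 2) / (1 + c * r ^ 2)

/-- The derivative of `liouvilleKernel`. -/
noncomputable def liouvilleKernelDeriv (c r : ℝ) : ℝ := -(4 * c * r) / (1 + c * r ^ 2) ^ 2

theorem hasDerivAt_liouvilleKernel {c : ℝ} (hc : 0 < c) (r : ℝ) :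
    HasDerivAt (liouvilleKernel c) (liouvilleKernelDeriv c r) r := by
  have h0 : 1 + c * r ^ 2 ≠ 0 := by positivity
  have hq : HasDerivAt (fun x : ℝ => c * x ^ 2) (c * (2 * r)) r := by
    simpa using (hasDerivAt_pow 2 r).const_mul c
  refine ((hq.const_sub 1).div (hq.const_add 1) h0).congr_deriv ?_
  unfold liouvilleKernelDeriv
  field_simp
  ring

theorem hasDerivAt_liouvilleKernelDeriv {c : ℝ} (hc : 0 < c) (r : ℝ) :
    HasDerivAt (liouvilleKernelDeriv c)
      (-(4 * c) * (1 - 3 * c * r ^ 2) / (1 + c * r ^ 2) ^ 3) r := by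
  have h0 : 1 + c * r ^ 2 ≠ 0 := by positivity
  have hq : HasDerivAt (fun x : ℝ => c * x ^ 2) (c * (2 * r)) r := by
    simpa using (hasDerivAt_pow 2 r).const_mul c
  have hn : HasDerivAt (fun x : ℝ => -(4 * c * x)) (-(4 * c)) r := by
    exact ((hasDerivAt_id r).const_mul (4 * c)).neg.congr_deriv (by simp)
  refine (hn.div ((hq.const_add 1).pow 2) (pow_ne_zero 2 h0)).congr_deriv ?_
  simp only [Pi.pow_apply]
  field_simp
  ring

theorem abs_liouvilleKernel_le_one {c : ℝ} (hc : 0 < c) (r : ℝ) : |liouvilleKernel c r| ≤ 1 := by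
  have h : 0 ≤ c * r ^ 2 := by positivity
  rw [liouvilleKernel, abs_div, abs_of_pos (by linarith : 0 < 1 + c * r ^ 2),
    div_le_one (by linarith), abs_le]
  constructor <;> linarith

theorem mul_abs_log_add_one_le {r : ℝ} (hr : 0 < r) : r * (|Real.log r| + 1) ≤ (1 + r) ^ 2 := by
  rcases le_total r 1 with h | h
  · have := Real.abs_log_mul_self_lt r hr h
    rw [abs_mul, abs_of_pos hr] at this
    nlinarith
  · rw [abs_of_nonneg (Real.log_nonneg h)]
    nlinarith [Real.log_le_sub_one_of_pos hr]

theorem half_le_log_two_add {r : ℝ} (hr : 0 < r) : 1 / 2 ≤ Real.log (2 + r) := by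
  have := Real.log_two_gt_d9
  have := Real.log_le_log two_pos (by linarith : 2 ≤ 2 + r)
  linarith

theorem abs_log_add_one_mul_le {r : ℝ} (hr : 0 < r) :
    (|Real.log r| + 1) * (r / (1 + r)) ≤ 3 * Real.log (2 + r) := by
  have hhalf := half_le_log_two_add hr
  rcases le_total r 1 with h | h
  · have := Real.abs_log_mul_self_lt r hr h
    rw [abs_mul, abs_of_pos hr] at this
    rw [← mul_div_assoc, div_le_iff₀ (by linarith)]
    nlinarith
  · rw [abs_of_nonneg (Real.log_nonneg h)]
    have h₁ : r / (1 + r) ≤ 1 := (div_le_one (by linarith)).2 (by linarith)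
    have h₂ := Real.log_le_log hr (by linarith : r ≤ 2 + r)
    have h₃ := Real.log_nonneg h
    nlinarith [mul_le_mul_of_nonneg_left h₁ (by linarith : 0 ≤ Real.log r + 1)]


/-- Variation-of-parameters estimate for the mode-0 (radial) linearized Liouville ODE:
there is `C = C(c) > 0` such that any `C²` solution of
`g'' + (1/r)g' + (8c/(1+cr²)²)g = E` on `(0,R)` with `g(0) = g'(0) = 0` and
`|E(r)| ≤ ε/(1+r)³` satisfies `|g(r)| ≤ C ε log(2+r)` on `(0,R]`. -/
theorem radial_ode_estimate (c : ℝ) (hc : 0 < c) :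
    ∃ C : ℝ, 0 < C ∧ ∀ R : ℝ, 1 < R → ∀ ε : ℝ, 0 < ε → ∀ E g : ℝ → ℝ,
      ContinuousOn E (Set.Ioc 0 R) →
      (∀ r ∈ Set.Ioc (0:ℝ) R, |E r| ≤ ε / (1 + r) ^ 3) →
      ContDiffOn ℝ 2 g (Set.Icc 0 R) →
      (∀ r ∈ Set.Ioo (0:ℝ) R,
        deriv (deriv g) r + (1 / r) * deriv g r + (8 * c / (1 + c * r ^ 2) ^ 2) * g r = E r) →
      g 0 = 0 → deriv g 0 = 0 →
      ∀ r ∈ Set.Ioc (0:ℝ) R, |g r| ≤ C * ε * Real.log (2 + r) := by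
  refine ⟨4, by norm_num, fun R hR ε hε E g _ hE hg hode hg0 _ r hr => ?_⟩
  have hU : UniqueDiffOn ℝ (Set.Icc 0 R) := uniqueDiffOn_Icc (by linarith)
  set p : ℝ → ℝ := derivWithin g (Set.Icc 0 R)
  have hpc : ContDiffOn ℝ 1 p (Set.Icc 0 R) := hg.derivWithin hU (by norm_num)
  have hpcont := hpc.continuousOn
  have hgcont := hg.continuousOn
  have hpderiv : ∀ x ∈ Set.Ioo 0 R, p x = deriv g x := fun x hx =>
    derivWithin_of_mem_nhds (Icc_mem_nhds hx.1 hx.2)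
  have hg' : ∀ x ∈ Set.Ioo 0 R, HasDerivAt g (p x) x := fun x hx => by
    rw [hpderiv x hx]
    exact ((hg.contDiffAt (Icc_mem_nhds hx.1 hx.2)).differentiableAt (by norm_num)).hasDerivAt
  have hp' : ∀ x ∈ Set.Ioo 0 R, HasDerivAt p
      (E x - (1 / x) * p x - (8 * c / (1 + c * x ^ 2) ^ 2) * g x) x := fun x hx => by
    refine ((hpc.contDiffAt (Icc_mem_nhds hx.1 hx.2)).differentiableAt
      (by norm_num)).hasDerivAt.congr_deriv ?_
    have heq : p =ᶠ[nhds x] deriv g :=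
      Filter.eventually_of_mem (isOpen_Ioo.mem_nhds hx) hpderiv
    rw [heq.deriv_eq, hpderiv x hx, ← hode x hx]
    ring
  set u := liouvilleKernel c with hu
  set v := liouvilleKernelDeriv c with hv
  have hu' := hasDerivAt_liouvilleKernel hc
  have hv' := hasDerivAt_liouvilleKernelDeriv hc
  have hucont : Continuous u := continuous_iff_continuousAt.2 fun x => (hu' x).continuousAt
  have hvcont : Continuous v := continuous_iff_continuousAt.2 fun x => (hv' x).continuousAt
  have hLcont : Continuous fun x : ℝ => x * Real.log x := Real.continuous_mul_log
  have hu1 := abs_liouvilleKernel_le_one hc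
  -- weighted Wronskians of `g` with the fundamental solutions `u` and `u * log + 1`
  set W₁ : ℝ → ℝ := fun x => x * (u x * p x - v x * g x) with hW₁
  set W₂ : ℝ → ℝ := fun x =>
    (u x * (x * Real.log x) + x) * p x - (v x * (x * Real.log x) + u x) * g x with hW₂
  have hW₁c : ContinuousOn W₁ (Set.Icc 0 R) := by fun_prop
  have hW₂c : ContinuousOn W₂ (Set.Icc 0 R) := by fun_prop
  have hW₁' : ∀ x ∈ Set.Ioo 0 R, HasDerivAt W₁ (x * u x * E x) x := fun x hx => by
    have h0 : 1 + c * x ^ 2 ≠ 0 := by positivity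
    have hx0 := hx.1.ne'
    refine ((hasDerivAt_id x).mul
      (((hu' x).mul (hp' x hx)).sub ((hv' x).mul (hg' x hx)))).congr_deriv ?_
    simp only [Pi.mul_apply, Pi.sub_apply, id, hu, liouvilleKernel, liouvilleKernelDeriv]
    field_simp
    ring
  have hW₂' : ∀ x ∈ Set.Ioo 0 R,
      HasDerivAt W₂ (x * (u x * Real.log x + 1) * E x) x := fun x hx => by
    have h0 : 1 + c * x ^ 2 ≠ 0 := by positivity
    have hx0 := hx.1.ne'
    have hL := (hasDerivAt_id x).mul (Real.hasDerivAt_log hx0)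
    refine (((((hu' x).mul hL).add (hasDerivAt_id x)).mul (hp' x hx)).sub
      ((((hv' x).mul hL).add (hu' x)).mul (hg' x hx))).congr_deriv ?_
    simp only [Pi.mul_apply, Pi.add_apply, id, hu, liouvilleKernel, liouvilleKernelDeriv]
    field_simp
    ring
  have hB₁ : ∀ x ∈ Set.Icc 0 R, |W₁ x| ≤ ε * (x / (1 + x)) := by
    refine abs_le_of_abs_hasDerivAt_le (B' := fun x => ε * (1 / (1 + x) ^ 2))
      hW₁c ?_ hW₁' ?_ ?_ (by simp [hW₁]) (by simp)
    · refine continuousOn_const.mul (continuousOn_id.div (by fun_prop) fun x hx => ?_)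
      linarith [hx.1]
    · intro x hx
      have h0 : 1 + x ≠ 0 := by linarith [hx.1]
      refine (((hasDerivAt_id x).div ((hasDerivAt_id x).const_add 1) h0).const_mul ε).congr_deriv ?_
      simp
    · intro x hx
      have hx0 := hx.1
      rw [abs_mul, abs_mul, abs_of_pos hx0]
      calc x * |u x| * |E x| ≤ (1 + x) * 1 * (ε / (1 + x) ^ 3) := by
            gcongr
            · linarith
            · exact hu1 x
            · exact hE x ⟨hx.1, hx.2.le⟩
        _ = ε * (1 / (1 + x) ^ 2) := by field_simp
  have hlog : ∀ x, |u x * Real.log x + 1| ≤ |Real.log x| + 1 := fun x => by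
    refine (abs_add_le _ _).trans ?_
    rw [abs_mul, abs_one]
    nlinarith [hu1 x, abs_nonneg (Real.log x)]
  have hB₂ : ∀ x ∈ Set.Icc 0 R, |W₂ x| ≤ ε * Real.log (1 + x) := by
    refine abs_le_of_abs_hasDerivAt_le (B' := fun x => ε * (1 / (1 + x)))
      hW₂c ?_ hW₂' ?_ ?_ (by simp [hW₂, hg0]) (by simp)
    · refine continuousOn_const.mul (ContinuousOn.log (by fun_prop) fun x hx => ?_)
      linarith [hx.1]
    · intro x hx
      have h0 : 1 + x ≠ 0 := by linarith [hx.1]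
      exact (((hasDerivAt_id x).const_add 1).log h0).const_mul ε
    · intro x hx
      have hx0 := hx.1
      rw [abs_mul, abs_mul, abs_of_pos hx0]
      calc x * |u x * Real.log x + 1| * |E x| ≤ (1 + x) ^ 2 * (ε / (1 + x) ^ 3) := by
            gcongr
            · exact (mul_le_mul_of_nonneg_left (hlog x) hx0.le).trans (mul_abs_log_add_one_le hx0)
            · exact hE x ⟨hx.1, hx.2.le⟩
        _ = ε * (1 / (1 + x)) := by field_simp
  have hr0 := hr.1
  have hrI : r ∈ Set.Icc 0 R := ⟨hr0.le, hr.2⟩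
  have hrep : g r = (u r * Real.log r + 1) * W₁ r - u r * W₂ r := by
    have h0 : 1 + c * r ^ 2 ≠ 0 := by positivity
    simp only [hW₁, hW₂, hu, hv, liouvilleKernel, liouvilleKernelDeriv]
    field_simp
    ring
  have hfirst : |(u r * Real.log r + 1) * W₁ r| ≤ ε * (3 * Real.log (2 + r)) := by
    rw [abs_mul]
    calc _ ≤ (|Real.log r| + 1) * (ε * (r / (1 + r))) :=
          mul_le_mul (hlog r) (hB₁ r hrI) (abs_nonneg _) (by positivity)
      _ = ε * ((|Real.log r| + 1) * (r / (1 + r))) := by ring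
      _ ≤ _ := mul_le_mul_of_nonneg_left (abs_log_add_one_mul_le hr0) hε.le
  have hsecond : |u r * W₂ r| ≤ ε * Real.log (2 + r) := by
    rw [abs_mul]
    calc _ ≤ 1 * (ε * Real.log (1 + r)) :=
          mul_le_mul (hu1 r) (hB₂ r hrI) (abs_nonneg _) zero_le_one
      _ ≤ _ := by
        rw [one_mul]
        gcongr
        norm_num
  rw [hrep]
  refine (abs_sub _ _).trans ?_
  linarith
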